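/- Let d be a positive integer, let x = (x_1, …, x_d) ∈ ℝ^d, let I be a positive integer, and let ε > 0. Then there exists a positive integer m that is a multiple of I such that m·x_1 ≤ ⟨m·x_1⟩ and max_{1 ≤ i ≤ d} |m·x_i − ⟨m·x_i⟩| < ε. -/

import Mathlib

/-- The round off of a real number `r`: the unique integer in `[r - 1/2, r + 1/2)`,
equivalently `⌈r - 1/2⌉`. -/
noncomputable def roundOff (r : ℝ) : ℤ := ⌈r - 1/2⌉

theorem roundOff_eq_of_abs_sub_lt {r : ℝ} {p : ℤ} (h : |r - p| < 1 / 2) : roundOff r = p := by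
  rw [abs_lt] at h
  rw [roundOff, Int.ceil_eq_iff]
  constructor <;> linarith

/-- Simultaneous Dirichlet approximation along the multiples of a positive integer. -/
theorem exists_multiple_forall_abs_mul_sub_lt {ι : Type*} [Fintype ι] (x : ι → ℝ) {k : ℕ}
    (hk : 0 < k) {δ : ℝ} (hδ : 0 < δ) :
    ∃ q : ℕ, 0 < q ∧ k ∣ q ∧ ∃ p : ι → ℤ, ∀ i, |(q : ℝ) * x i - p i| < δ := by
  let u : ℕ → ι → ℝ := fun n i => Int.fract (((n * k : ℕ) : ℝ) * x i)
  have hu : ∀ n, u n ∈ Set.Icc (0 : ι → ℝ) 1 := fun n =>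
    ⟨fun i => Int.fract_nonneg _, fun i => (Int.fract_lt_one _).le⟩
  obtain ⟨a, -, φ, hφ, ha⟩ := isCompact_Icc.tendsto_subseq hu
  obtain ⟨N, hN⟩ := Metric.cauchySeq_iff.1 ha.cauchySeq δ hδ
  have hdist := hN (N + 1) (Nat.le_succ N) N le_rfl
  have hlt : φ N < φ (N + 1) := hφ (Nat.lt_succ_self N)
  refine ⟨(φ (N + 1) - φ N) * k, Nat.mul_pos (Nat.sub_pos_of_lt hlt) hk, Dvd.intro_left _ rfl,
    fun i => ⌊((φ (N + 1) * k : ℕ) : ℝ) * x i⌋ - ⌊((φ N * k : ℕ) : ℝ) * x i⌋, fun i => ?_⟩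
  have hi := (dist_le_pi_dist _ _ i).trans_lt hdist
  simp only [Function.comp_apply, u, Real.dist_eq, Int.fract] at hi
  refine (congrArg abs ?_).trans_lt hi
  push_cast [Nat.cast_sub hlt.le]
  ring

/-- **Kawamata's approximation lemma.** Given `x ∈ ℝ^d`, a positive integer `I` and
`ε > 0`, there is a positive multiple `m` of `I` with `m·x₁ ≤ ⟨m·x₁⟩` and
`|m·xᵢ - ⟨m·xᵢ⟩| < ε` for all `i`. -/
theorem kawamata_approximation (d : ℕ) (hd : 0 < d) (x : Fin d → ℝ)
    (I : ℕ) (hI : 0 < I) (ε : ℝ) (hε : 0 < ε) :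
    ∃ m : ℕ, 0 < m ∧ I ∣ m ∧
      (m : ℝ) * x ⟨0, hd⟩ ≤ (roundOff ((m : ℝ) * x ⟨0, hd⟩) : ℝ) ∧
      ∀ i : Fin d, |(m : ℝ) * x i - (roundOff ((m : ℝ) * x i) : ℝ)| < ε := by
  suffices h : ∃ m : ℕ, 0 < m ∧ I ∣ m ∧ ∃ p : Fin d → ℤ,
      (m : ℝ) * x ⟨0, hd⟩ ≤ p ⟨0, hd⟩ ∧ ∀ i, |(m : ℝ) * x i - p i| < min ε (1 / 2) by
    obtain ⟨m, hm, hIm, p, hp, hpx⟩ := h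
    have hround : ∀ i, roundOff ((m : ℝ) * x i) = p i := fun i =>
      roundOff_eq_of_abs_sub_lt ((hpx i).trans_le (min_le_right _ _))
    refine ⟨m, hm, hIm, ?_, fun i => ?_⟩
    · rwa [hround]
    · rw [hround]
      exact (hpx i).trans_le (min_le_left _ _)
  have hδ : 0 < min ε (1 / 2) := lt_min hε (by norm_num)
  generalize min ε (1 / 2) = δ at hδ
  obtain ⟨q, hq, hIq, p, hp⟩ := exists_multiple_forall_abs_mul_sub_lt x hI (half_pos hδ)
  rcases le_or_gt ((q : ℝ) * x ⟨0, hd⟩) (p ⟨0, hd⟩) with h | h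
  · exact ⟨q, hq, hIq, p, h, fun i => (hp i).trans (half_lt_self hδ)⟩
  · obtain ⟨r, hr, hkr, s, hs⟩ := exists_multiple_forall_abs_mul_sub_lt x
      (Nat.mul_pos q.succ_pos hI) (sub_pos.2 h)
    have hqr : q < r := Nat.le_of_dvd hr ((Nat.dvd_mul_right _ _).trans hkr)
    have hp₀ := abs_lt.1 (hp ⟨0, hd⟩)
    refine ⟨r - q, Nat.sub_pos_of_lt hqr,
      Nat.dvd_sub ((Nat.dvd_mul_left _ _).trans hkr) hIq, fun i => s i - p i, ?_, fun i => ?_⟩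
    · have hs₀ := abs_lt.1 (hs ⟨0, hd⟩)
      push_cast [Nat.cast_sub hqr.le]
      linarith
    · have hpi := abs_lt.1 (hp i)
      have hsi := abs_lt.1 (hs i)
      push_cast [Nat.cast_sub hqr.le]
      rw [abs_lt]
      constructor <;> linarith
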